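/- Let E be a real normed space, z : ℕ → E a sequence such that Σ_{p=0}^{∞} ‖z^{p+1} − z^p‖ < ∞ and z^t converges to z* ∈ E, and define Δ_t = Σ_{p=t}^{∞} ‖z^{p+1} − z^p‖. Let θ ∈ (1/2, 1) and c₁ > 0, and assume Δ_t ≤ c₁·(Δ_t − Δ_{t+1})^{(1−θ)/θ} for every t. Then there exists γ > 0 such that ‖z^t − z*‖ ≤ γ·t^{−(1−θ)/(2θ−1)} for all t ≥ 1. -/

import Mathlib

/-- Bernoulli's inequality for negative exponents. -/
theorem one_sub_mul_le_rpow_neg {x ρ : ℝ} (hx : 0 < x) (hρ : 0 ≤ ρ) :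
    1 - ρ * (x - 1) ≤ x ^ (-ρ) := by
  rw [Real.rpow_def_of_pos hx]
  have hlog := mul_le_mul_of_nonneg_left (Real.log_le_sub_one_of_pos hx) hρ
  linarith [Real.add_one_le_exp (Real.log x * -ρ)]

/-- If `k * a ^ (1 + ρ) ≤ a - b`, then passing from `a` to `b` increases the power `-ρ`
by at least `ρ * k`. -/
theorem rpow_neg_add_le_rpow_neg {a b k ρ : ℝ} (ha : 0 < a) (hb : 0 < b) (hρ : 0 ≤ ρ)
    (h : k * a ^ (1 + ρ) ≤ a - b) : a ^ (-ρ) + ρ * k ≤ b ^ (-ρ) := by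
  have hpow : 0 < a ^ ρ := Real.rpow_pos_of_pos ha ρ
  have hbern := one_sub_mul_le_rpow_neg (div_pos hb ha) hρ
  rw [Real.div_rpow hb.le ha.le, Real.rpow_neg ha.le, div_inv_eq_mul] at hbern
  rw [Real.rpow_add ha, Real.rpow_one] at h
  have hstep : k * a ^ ρ ≤ 1 - b / a := by
    rw [one_sub_div ha.ne', le_div_iff₀ ha]
    linarith
  have hscaled := mul_le_mul_of_nonneg_left hstep hρ
  rw [Real.rpow_neg ha.le]
  refine le_of_mul_le_mul_right ?_ hpow
  rw [add_mul, inv_mul_cancel₀ hpow.ne']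
  linarith

/-- A nonnegative sequence with `k * u t ^ (1 + ρ) ≤ u t - u (t + 1)` decays at least
like `t ^ (-1 / ρ)`. -/
theorem le_rpow_of_mul_rpow_le_sub {u : ℕ → ℝ} {k ρ : ℝ} (hu : ∀ t, 0 ≤ u t)
    (hk : 0 < k) (hρ : 0 < ρ) (h : ∀ t, k * u t ^ (1 + ρ) ≤ u t - u (t + 1))
    {t : ℕ} (ht : 1 ≤ t) : u t ≤ (ρ * k * t) ^ (-1 / ρ) := by
  have hgrow : ∀ n : ℕ, 0 < u n → ρ * k * n ≤ u n ^ (-ρ) := by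
    intro n
    induction n with
    | zero =>
      intro hn
      simpa using Real.rpow_nonneg hn.le (-ρ)
    | succ n ih =>
      intro hn
      have hdecr : u (n + 1) ≤ u n := by
        have := mul_nonneg hk.le (Real.rpow_nonneg (hu n) (1 + ρ))
        linarith [h n]
      have hpos := hn.trans_le hdecr
      have := rpow_neg_add_le_rpow_neg hpos hn hρ.le (h n)
      push_cast
      linarith [ih hpos]
  have htpos : (0 : ℝ) < t := by exact_mod_cast ht
  have hbase : 0 < ρ * k * t := by positivity
  rcases (hu t).eq_or_lt with hzero | hpos
  · rw [← hzero]
    positivity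
  · have hexp : -1 / ρ ≤ 0 := div_nonpos_of_nonpos_of_nonneg (by norm_num) hρ.le
    have := Real.rpow_le_rpow_of_nonpos hbase (hgrow t hpos) hexp
    rwa [← Real.rpow_mul hpos.le, show -ρ * (-1 / ρ) = 1 by field_simp,
      Real.rpow_one] at this

/-- If the tails `Δ_t = Σ_{p≥t} ‖z^{p+1} − z^p‖` satisfy
`Δ_t ≤ c₁·(Δ_t − Δ_{t+1})^{(1−θ)/θ}` with `θ ∈ (1/2, 1)`, then the sequence
converges sublinearly: `‖z^t − z*‖ ≤ γ·t^{−(1−θ)/(2θ−1)}` for some `γ > 0`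
and all `t ≥ 1`. -/
theorem sublinear_rate_of_tail_ineq {E : Type*} [NormedAddCommGroup E] [NormedSpace ℝ E]
    (z : ℕ → E) (zstar : E)
    (hsum : Summable fun p : ℕ => ‖z (p + 1) - z p‖)
    (hconv : Filter.Tendsto z Filter.atTop (nhds zstar))
    (Δ : ℕ → ℝ) (hΔ : ∀ t : ℕ, Δ t = ∑' p : ℕ, ‖z (t + p + 1) - z (t + p)‖)
    (θ c₁ : ℝ) (hθ0 : 1 / 2 < θ) (hθ1 : θ < 1) (hc₁ : 0 < c₁)
    (h : ∀ t : ℕ, Δ t ≤ c₁ * (Δ t - Δ (t + 1)) ^ ((1 - θ) / θ)) :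
    ∃ γ > (0 : ℝ), ∀ t : ℕ, 1 ≤ t →
      ‖z t - zstar‖ ≤ γ * (t : ℝ) ^ (-(1 - θ) / (2 * θ - 1)) := by
  have hθ : 0 < 1 - θ := by linarith
  have hθ' : 0 < 2 * θ - 1 := by linarith
  have hθ'' : 0 < θ := by linarith
  have hnonneg : ∀ t, 0 ≤ Δ t := fun t ↦ by
    rw [hΔ]
    exact tsum_nonneg fun _ ↦ norm_nonneg _
  have hdiff : ∀ t, 0 ≤ Δ t - Δ (t + 1) := fun t ↦ by
    have hs : Summable fun p : ℕ ↦ ‖z (t + p + 1) - z (t + p)‖ := by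
      simpa only [add_comm t] using (summable_nat_add_iff t).2 hsum
    have hsplit := hs.tsum_eq_zero_add
    simp only [add_zero, ← add_assoc] at hsplit
    rw [hΔ t, hΔ (t + 1), hsplit]
    simp only [add_right_comm t 1, add_sub_cancel_right]
    exact norm_nonneg _
  have hdist : ∀ t, ‖z t - zstar‖ ≤ Δ t := fun t ↦ by
    rw [hΔ, ← dist_eq_norm]
    exact dist_le_tsum_of_dist_le_of_tendsto (fun p ↦ ‖z (p + 1) - z p‖)
      (fun n ↦ by rw [dist_comm, dist_eq_norm]) hsum hconv t
  set ρ : ℝ := (2 * θ - 1) / (1 - θ) with hρ_def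
  have hρ : 0 < ρ := div_pos hθ' hθ
  set k : ℝ := (c₁ ^ (1 + ρ))⁻¹ with hk_def
  have hk : 0 < k := inv_pos.2 (Real.rpow_pos_of_pos hc₁ _)
  have hrec : ∀ t, k * Δ t ^ (1 + ρ) ≤ Δ t - Δ (t + 1) := fun t ↦ by
    have hpow := Real.rpow_le_rpow (hnonneg t) (h t) (by positivity : 0 ≤ 1 + ρ)
    have hmul : (1 - θ) / θ * (1 + ρ) = 1 := by
      rw [hρ_def]
      field_simp
      ring
    rw [Real.mul_rpow hc₁.le (Real.rpow_nonneg (hdiff t) _), ← Real.rpow_mul (hdiff t),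
      hmul, Real.rpow_one] at hpow
    exact (inv_mul_le_iff₀ (Real.rpow_pos_of_pos hc₁ _)).2 hpow
  refine ⟨(ρ * k) ^ (-1 / ρ), Real.rpow_pos_of_pos (mul_pos hρ hk) _, fun t ht ↦ ?_⟩
  have hexp : -(1 - θ) / (2 * θ - 1) = -1 / ρ := by
    rw [hρ_def]
    field_simp
  rw [hexp, ← Real.mul_rpow (mul_pos hρ hk).le t.cast_nonneg]
  exact (hdist t).trans (le_rpow_of_mul_rpow_le_sub hnonneg hk hρ hrec ht)
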